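/- arXiv:2411.10653 — 2 statements merged into one kernel-verified Lean document; each statement's English description precedes it below -/
import Mathlib

section
/- Let S_1,…,S_f (f ≥ 1) be nonempty strings over an alphabet Σ, let k ≥ 1, let ℓ ≥ 3 be minimal with k(ℓ−2) > |S_1| + ⋯ + |S_f|, and let S be the ED string constructed from S_1,…,S_f, k, ℓ as described. Then there exist a string T ∈ L(S) and a position i of T with longest-previous-factor length LPF(T)[i] ≥ (k+1)(f+ℓ)+1 if and only if S_1,…,S_f have a common subsequence of length k. -/
/-- The language of an ED string `S` (a list of sets of strings):
all concatenations `w_1 ⋯ w_N` with `w_i ∈ S[i]`. -/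
def GLang {α : Type*} (S : List (Set (List α))) : Set (List α) :=
  {T | ∃ ws : List (List α), List.Forall₂ (fun w A => w ∈ A) ws S ∧ ws.flatten = T}

/- We model the alphabet `Σ ∪ {$}` as `Option α`: the character `$ ∉ Σ` is
`none` and a character `x ∈ Σ` is `some x`. -/

/-- The ED symbol `Σ_ε = { x : x ∈ Σ } ∪ {ε}`, matching any one character of `Σ`
or nothing. -/
def sigmaEps (α : Type*) : Set (List (Option α)) :=
  {w | w = [] ∨ ∃ x : α, w = [some x]}

/-- The ED symbol `{$}` containing only the one-character string `$`. -/
def dolS (α : Type*) : Set (List (Option α)) := {[none]}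

/-- The ED string `Ŝ_w = ({w[1], ε})({w[2], ε}) ⋯ ({w[|w|], ε})`,
whose language is the set of subsequences of `w`. -/
def subseqED {α : Type*} (w : List α) : List (Set (List (Option α))) :=
  w.map fun c => ({[some c], []} : Set (List (Option α)))

/-- The ED string
`S = ({$} Σ_ε^k)^ℓ · {$} · Ŝ_1 · {$} · ⋯ · {$} · Ŝ_f · {$} · Σ_ε^k · {$}`
of the LPF reduction, built from the strings `SS = [S_1, …, S_f]` and the
integers `k` and `ℓ`. -/
def lpfS {α : Type*} (SS : List (List α)) (k ℓ : ℕ) : List (Set (List (Option α))) :=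
  (List.replicate ℓ ([dolS α] ++ List.replicate k (sigmaEps α))).flatten ++
    [dolS α] ++ (SS.map fun w => subseqED w ++ [dolS α]).flatten ++
    List.replicate k (sigmaEps α) ++ [dolS α]

namespace LPFAux

def encB {α : Type*} : List (List α) → List (Option α)
  | [] => []
  | X :: Xs => none :: (X.map some ++ encB Xs)

theorem encB_append {α : Type*} (A B : List (List α)) : encB (A ++ B) = encB A ++ encB B := by
  induction A with
  | nil => rfl
  | cons a A ih => simp [encB, ih]

theorem GLang_nil {α : Type*} (T : List α) : T ∈ GLang ([] : List (Set (List α))) ↔ T = [] := by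
  constructor
  · rintro ⟨ws, h, rfl⟩
    cases h; rfl
  · rintro rfl
    exact ⟨[], List.Forall₂.nil, rfl⟩

theorem GLang_cons {α : Type*} (T : List α) (A : Set (List α)) (S : List (Set (List α))) :
    T ∈ GLang (A :: S) ↔ ∃ u ∈ A, ∃ v ∈ GLang S, T = u ++ v := by
  constructor
  · rintro ⟨ws, h, rfl⟩
    cases h with
    | cons h1 h2 => exact ⟨_, h1, _, ⟨_, h2, rfl⟩, by simp⟩
  · rintro ⟨u, hu, v, ⟨ws, h, rfl⟩, rfl⟩
    exact ⟨u :: ws, List.Forall₂.cons hu h, by simp⟩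

theorem GLang_append {α : Type*} (A B : List (Set (List α))) (T : List α) :
    T ∈ GLang (A ++ B) ↔ ∃ u ∈ GLang A, ∃ v ∈ GLang B, T = u ++ v := by
  induction A generalizing T with
  | nil => simp [GLang_nil]
  | cons a A ih =>
    simp only [List.cons_append, GLang_cons, ih]
    constructor
    · rintro ⟨u, hu, v, ⟨w, hw, z, hz, rfl⟩, rfl⟩
      exact ⟨u ++ w, ⟨u, hu, w, hw, rfl⟩, z, hz, by simp⟩
    · rintro ⟨_, ⟨u, hu, w, hw, rfl⟩, z, hz, rfl⟩
      exact ⟨u, hu, w ++ z, ⟨w, hw, z, hz, rfl⟩, by simp⟩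

theorem GLang_dol {α : Type*} (T : List (Option α)) : T ∈ GLang [dolS α] ↔ T = [none] := by
  simp [GLang_cons, GLang_nil, dolS]

theorem GLang_sig {α : Type*} (k : ℕ) (T : List (Option α)) :
    T ∈ GLang (List.replicate k (sigmaEps α)) ↔ ∃ X : List α, X.length ≤ k ∧ T = X.map some := by
  induction k generalizing T with
  | zero =>
    simp [GLang_nil]
  | succ k ih =>
    simp only [List.replicate_succ, GLang_cons, ih]
    constructor
    · rintro ⟨u, (rfl | ⟨x, rfl⟩), v, ⟨X, hX, rfl⟩, rfl⟩
      · exact ⟨X, by omega, by simp⟩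
      · exact ⟨x :: X, by simpa using hX, by simp⟩
    · rintro ⟨X, hX, rfl⟩
      cases X with
      | nil => exact ⟨[], Or.inl rfl, [], ⟨[], by simp, by simp⟩, by simp⟩
      | cons x X =>
        exact ⟨[some x], Or.inr ⟨x, rfl⟩, _, ⟨X, by simpa using hX, rfl⟩, by simp⟩

theorem GLang_sub {α : Type*} (w : List α) (T : List (Option α)) :
    T ∈ GLang (subseqED w) ↔ ∃ X : List α, X.Sublist w ∧ T = X.map some := by
  induction w generalizing T with
  | nil => simp [subseqED, GLang_nil]
  | cons c w ih =>
    have : subseqED (c :: w) = ({[some c], []} : Set (List (Option α))) :: subseqED w := rfl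
    rw [this]
    simp only [GLang_cons, ih]
    constructor
    · rintro ⟨u, (rfl | rfl), v, ⟨X, hX, rfl⟩, rfl⟩
      · exact ⟨c :: X, hX.cons_cons c, by simp⟩
      · exact ⟨X, hX.cons c, by simp⟩
    · rintro ⟨X, hX, rfl⟩
      cases hX with
      | cons _ h => exact ⟨[], Or.inr rfl, _, ⟨X, h, rfl⟩, by simp⟩
      | cons_cons _ h => exact ⟨_, Or.inl rfl, _, ⟨_, h, rfl⟩, by simp⟩

theorem GLang_B {α : Type*} (k ℓ : ℕ) (T : List (Option α)) :
    T ∈ GLang (List.replicate ℓ ([dolS α] ++ List.replicate k (sigmaEps α))).flatten ↔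
      ∃ Bs : List (List α), Bs.length = ℓ ∧ (∀ B ∈ Bs, B.length ≤ k) ∧ T = encB Bs := by
  induction ℓ generalizing T with
  | zero =>
    simp only [List.replicate_zero, List.flatten_nil, GLang_nil]
    constructor
    · rintro rfl; exact ⟨[], rfl, by simp, rfl⟩
    · rintro ⟨Bs, h, -, rfl⟩
      rw [List.length_eq_zero_iff] at h; subst h; rfl
  | succ n ih =>
    simp only [List.replicate_succ, List.flatten_cons, GLang_append, ih, GLang_sig, GLang_dol]
    constructor
    · rintro ⟨_, ⟨_, rfl, _, ⟨X, hX, rfl⟩, rfl⟩, _, ⟨Bs, h1, h2, rfl⟩, rfl⟩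
      exact ⟨X :: Bs, by simp [h1], by simpa using ⟨hX, h2⟩, by simp [encB]⟩
    · rintro ⟨Bs, h1, h2, rfl⟩
      cases Bs with
      | nil => simp at h1
      | cons X Bs =>
        simp only [List.mem_cons, forall_eq_or_imp] at h2
        exact ⟨_, ⟨_, rfl, _, ⟨X, h2.1, rfl⟩, rfl⟩, _, ⟨Bs, by simpa using h1, h2.2, rfl⟩,
          by simp [encB]⟩

theorem GLang_C {α : Type*} (SS : List (List α)) (T : List (Option α)) :
    T ∈ GLang (SS.map fun w => subseqED w ++ [dolS α]).flatten ↔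
      ∃ Cs : List (List α), List.Forall₂ List.Sublist Cs SS ∧
        none :: T = encB Cs ++ [none] := by
  induction SS generalizing T with
  | nil =>
    simp [GLang_nil, encB]
  | cons w SS ih =>
    simp only [List.map_cons, List.flatten_cons, GLang_append, ih, GLang_sub, GLang_dol]
    constructor
    · rintro ⟨_, ⟨_, ⟨X, hX, rfl⟩, _, rfl, rfl⟩, T', ⟨Cs, h1, h2⟩, rfl⟩
      exact ⟨X :: Cs, List.Forall₂.cons hX h1, by simp [encB, ← h2]⟩
    · rintro ⟨Cs, h1, h2⟩
      cases h1 with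
      | @cons X _ Cs _ hX h1 =>
        have : ∃ T', none :: T' = encB Cs ++ [none] := by
          cases Cs with
          | nil => exact ⟨[], rfl⟩
          | cons a Cs => exact ⟨_, rfl⟩
        obtain ⟨T', hT'⟩ := this
        refine ⟨_, ⟨_, ⟨X, hX, rfl⟩, _, rfl, rfl⟩, T', ⟨Cs, h1, hT'⟩, ?_⟩
        simpa [encB, ← hT'] using h2

theorem GLang_lpfS {α : Type*} (SS : List (List α)) (k ℓ : ℕ) (T : List (Option α)) :
    T ∈ GLang (lpfS SS k ℓ) ↔ ∃ (Bs Cs : List (List α)) (D : List α),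
      Bs.length = ℓ ∧ (∀ B ∈ Bs, B.length ≤ k) ∧ List.Forall₂ List.Sublist Cs SS ∧
      D.length ≤ k ∧ T = encB (Bs ++ Cs ++ [D]) ++ [none] := by
  unfold lpfS
  simp only [GLang_append, GLang_B, GLang_C, GLang_sig, GLang_dol]
  constructor
  · rintro ⟨_, ⟨_, ⟨_, ⟨_, ⟨Bs, h1, h2, rfl⟩, _, rfl, rfl⟩, T', ⟨Cs, h3, h4⟩, rfl⟩, _,
      ⟨D, h5, rfl⟩, rfl⟩, _, rfl, rfl⟩
    refine ⟨Bs, Cs, D, h1, h2, h3, h5, ?_⟩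
    have : encB Bs ++ [none] ++ T' = encB Bs ++ (encB Cs ++ [none]) := by
      rw [← h4]; simp
    rw [this]
    simp [encB_append, encB]
  · rintro ⟨Bs, Cs, D, h1, h2, h3, h5, rfl⟩
    have : ∃ T', none :: T' = encB Cs ++ [none] := by
      cases Cs with
      | nil => exact ⟨[], rfl⟩
      | cons a Cs => exact ⟨_, rfl⟩
    obtain ⟨T', h4⟩ := this
    refine ⟨_, ⟨_, ⟨_, ⟨_, ⟨Bs, h1, h2, rfl⟩, _, rfl, rfl⟩, T', ⟨Cs, h3, h4⟩, rfl⟩, _,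
      ⟨D, h5, rfl⟩, rfl⟩, _, rfl, ?_⟩
    have : encB Bs ++ [none] ++ T' = encB Bs ++ (encB Cs ++ [none]) := by
      rw [← h4]; simp
    rw [this]
    simp [encB_append, encB]

theorem encB_length {α : Type*} (Xs : List (List α)) :
    (encB Xs).length = (Xs.map List.length).sum + Xs.length := by
  induction Xs with
  | nil => rfl
  | cons a A ih => simp [encB, ih]; omega

/-- number of dollars among first `x` characters -/
def cn {α : Type*} (T : List (Option α)) (x : ℕ) : ℕ := (T.take x).countP Option.isNone

theorem cn_zero {α : Type*} (T : List (Option α)) : cn T 0 = 0 := by simp [cn]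

theorem cn_mono {α : Type*} (T : List (Option α)) {x y : ℕ} (h : x ≤ y) : cn T x ≤ cn T y :=
  List.Sublist.countP_le (List.take_sublist_take_left h)

theorem cn_add {α : Type*} (T : List (Option α)) (a b : ℕ) :
    cn T (a + b) = cn T a + ((T.drop a).take b).countP Option.isNone := by
  simp [cn, List.take_add]

theorem cn_dol {α : Type*} (T : List (Option α)) (x : ℕ) (h : T[x]? = some none) :
    cn T (x + 1) = cn T x + 1 := by
  simp [cn, List.take_add_one, h]

theorem countP_map_some {α : Type*} (X : List α) :
    (X.map some).countP Option.isNone = 0 := by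
  simp [List.countP_eq_zero]

theorem countP_encB {α : Type*} (Xs : List (List α)) :
    (encB Xs).countP Option.isNone = Xs.length := by
  induction Xs with
  | nil => rfl
  | cons a A ih => simp [encB, ih, -List.countP_map, countP_map_some]

theorem head_enc {α : Type*} (Xs : List (List α)) (Q : List (Option α)) :
    (encB Xs ++ none :: Q)[0]? = some none := by
  cases Xs <;> simp [encB]

theorem window0 {α : Type*} (k : ℕ) (Bs : List (List α)) (hB : ∀ B ∈ Bs, B.length ≤ k)
    (Q : List (Option α)) (t : ℕ) (ht : t ≤ (encB Bs).length) :
    ∃ x, t ≤ x ∧ x ≤ t + k ∧ (encB Bs ++ none :: Q)[x]? = some none := by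
  induction Bs generalizing t with
  | nil =>
    simp [encB] at ht
    subst ht
    exact ⟨0, by simp, by simp, by simp [encB]⟩
  | cons B Bs ih =>
    simp only [List.mem_cons, forall_eq_or_imp] at hB
    have key : ∀ y, (encB (B :: Bs) ++ none :: Q)[B.length + 1 + y]?
        = (encB Bs ++ none :: Q)[y]? := by
      intro y
      have : encB (B :: Bs) ++ none :: Q
        = (none :: B.map some) ++ (encB Bs ++ none :: Q) := by simp [encB]
      rw [this, List.getElem?_append_right (by simp)]
      congr 1
      simp
    rcases Nat.eq_zero_or_pos t with rfl | h0
    · exact ⟨0, by simp, by simp, head_enc _ _⟩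
    by_cases h1 : t ≤ B.length + 1
    · refine ⟨B.length + 1 + 0, by omega, by omega, ?_⟩
      rw [key]; exact head_enc _ _
    · have hl : (encB (B :: Bs)).length = B.length + 1 + (encB Bs).length := by
        simp [encB]; omega
      obtain ⟨x, hx1, hx2, hx3⟩ := ih hB.2 (t - (B.length + 1)) (by omega)
      exact ⟨B.length + 1 + x, by omega, by omega, by rw [key]; exact hx3⟩

theorem prefix_map_some {α : Type*} (X Y : List α) (P Q : List (Option α))
    (h : (X.map some ++ none :: P) <+: (Y.map some ++ none :: Q)) :
    X = Y ∧ P <+: Q := by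
  induction X generalizing Y with
  | nil =>
    cases Y with
    | nil => simpa using h
    | cons y Y => simp at h
  | cons x X ih =>
    cases Y with
    | nil => simp at h
    | cons y Y =>
      simp only [List.map_cons, List.cons_append, List.cons_prefix_cons, Option.some.injEq] at h
      obtain ⟨h1, h2⟩ := ih Y h.2
      exact ⟨by rw [h.1, h1], h2⟩

theorem enc_cons {α : Type*} (Xs : List (List α)) :
    ∃ T', encB Xs ++ [none] = none :: T' := by
  cases Xs with
  | nil => exact ⟨[], rfl⟩
  | cons a Cs => exact ⟨_, rfl⟩

theorem enc_prefix {α : Type*} (Xs Ys : List (List α))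
    (h : (encB Xs ++ [none]) <+: (encB Ys ++ [none])) : Xs <+: Ys := by
  induction Xs generalizing Ys with
  | nil => simp
  | cons X Xs ih =>
    cases Ys with
    | nil =>
      have := h.length_le
      simp [encB] at this
    | cons Y Ys =>
      obtain ⟨P, hP⟩ := enc_cons Xs
      obtain ⟨Q, hQ⟩ := enc_cons Ys
      simp only [encB, List.cons_append, List.append_assoc, hP, hQ, List.cons_prefix_cons,
        true_and] at h
      obtain ⟨h1, h2⟩ := prefix_map_some X Y P Q h
      have := ih Ys (by rw [hP, hQ]; simpa using h2)
      simp [h1, this]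

theorem all_eq_of_prefix {α : Type*} (X : α) (Xs : List α) (h : Xs <+: X :: Xs) :
    ∀ Y ∈ Xs, Y = X := by
  induction Xs generalizing X with
  | nil => simp
  | cons Z Xs ih =>
    rw [List.cons_prefix_cons] at h
    obtain ⟨rfl, h⟩ := h
    simpa using ih Z h

/-- positional argument -/
theorem main_pos {α : Type*} (T : List (Option α)) (k N i j L q : ℕ) (hN : 1 ≤ N)
    (hwin : ∀ t ≤ q, ∃ x, t ≤ x ∧ x ≤ t + k ∧ T[x]? = some none)
    (hji : j < i) (hiL : i + L ≤ T.length) (hiq : i ≤ q)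
    (heq : (T.drop j).take L = (T.drop i).take L)
    (hL : (k + 1) * N + 1 ≤ L)
    (hcnt : cn T T.length = N + 2)
    (h0 : T[0]? = some none) (hlast : T[T.length - 1]? = some none) :
    j = 0 ∧ i + L = T.length ∧ cn T i = 1 := by
  have hper : ∀ y < L, T[j + y]? = T[i + y]? := by
    intro y hy
    have := congrArg (fun l => l[y]?) heq
    simpa [List.getElem?_take, hy, List.getElem?_drop] using this
  have hcp : ∀ y ≤ L, cn T (j + y) + cn T i = cn T (i + y) + cn T j := by
    intro y hy
    have := congrArg (List.take y) heq
    rw [List.take_take, List.take_take, min_eq_left hy] at this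
    rw [cn_add, cn_add, this]; omega
  have hw : ∀ t, j ≤ t → t + k < i + L → ∃ x, t ≤ x ∧ x ≤ t + k ∧ T[x]? = some none := by
    intro t
    induction t using Nat.strong_induction_on with
    | _ t ih =>
      intro hjt htk
      by_cases htq : t ≤ q
      · exact hwin t htq
      · obtain ⟨x, hx1, hx2, hx3⟩ := ih (t - (i - j)) (by omega) (by omega) (by omega)
        refine ⟨x + (i - j), by omega, by omega, ?_⟩
        have := hper (x - j) (by omega)
        rw [show j + (x - j) = x by omega, show i + (x - j) = x + (i - j) by omega] at this
        rw [← this, hx3]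
  have hwc : ∀ n t, j ≤ t → t + (k + 1) * n ≤ i + L → cn T t + n ≤ cn T (t + (k + 1) * n) := by
    intro n
    induction n with
    | zero => intros; simp
    | succ n ih =>
      intro t h1 h2
      rw [Nat.mul_succ] at h2 ⊢
      have h3 := ih t h1 (by omega)
      obtain ⟨x, hx1, hx2, hx3⟩ := hw (t + (k + 1) * n) (by omega) (by omega)
      have h4 := cn_dol T x hx3
      have h5 := cn_mono T hx1
      have h6 := cn_mono T (show x + 1 ≤ t + ((k + 1) * n + (k + 1)) by omega)
      omega
  have hkN : k + 1 ≤ (k + 1) * N := Nat.le_mul_of_pos_right _ hN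
  -- first: cn i ≥ cn j + 1
  have hij : cn T j + 1 ≤ cn T i := by
    by_contra hcon
    have hm := cn_mono T hji.le
    obtain ⟨x, hx1, hx2, hx3⟩ := hw j le_rfl (by omega)
    have h1 := cn_dol T x hx3
    have h2 := hcp (x - j) (by omega)
    have h3 := cn_mono T (show x + 1 ≤ i + (x - j) by omega)
    rw [show j + (x - j) = x by omega] at h2
    omega
  have hd0 := cn_dol T 0 h0
  rw [cn_zero] at hd0
  have hdl := cn_dol T _ hlast
  rw [show T.length - 1 + 1 = T.length by omega, hcnt] at hdl
  have hjpos : 0 < j → 1 ≤ cn T j := by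
    intro h
    have := cn_mono T (show 0 + 1 ≤ j by omega)
    omega
  have hend : i + L < T.length → cn T (i + L) ≤ N + 1 := by
    intro h
    have := cn_mono T (show i + L ≤ T.length - 1 by omega)
    omega
  have hle : cn T (i + L) ≤ N + 2 := by
    rw [← hcnt]; exact cn_mono T hiL
  have hA := hcp L le_rfl
  have hB := hwc N i hji.le (by omega)
  have hB' := cn_mono T (show i + (k + 1) * N ≤ i + L by omega)
  have hC : j = 0 → N + 1 ≤ cn T (j + L) := by
    intro h
    have h1 := hwc N 1 (by omega) (by omega)
    have h2 := cn_mono T (show 1 + (k + 1) * N ≤ j + L by omega)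
    simp only [zero_add] at hd0
    omega
  have hD : i + L = T.length → cn T i + N + 1 ≤ cn T (i + L) := by
    intro h
    have h2 := cn_mono T (show i + (k + 1) * N ≤ T.length - 1 by omega)
    rw [h, hcnt]
    omega
  have hj0 : cn T 0 = 0 := cn_zero T
  rcases Nat.eq_zero_or_pos j with hj | hj
  · have := hC hj
    subst hj
    rcases Nat.lt_or_ge (i + L) T.length with h | h
    · have := hend h; omega
    · refine ⟨rfl, by omega, ?_⟩; omega
  · have := hjpos hj
    rcases Nat.lt_or_ge (i + L) T.length with h | h
    · have := hend h; omega
    · have := hD (by omega); omega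

theorem sum_sub {α : Type*} (Cs SS : List (List α)) (h : List.Forall₂ List.Sublist Cs SS) :
    (Cs.map List.length).sum ≤ (SS.map List.length).sum := by
  induction h with
  | nil => simp
  | cons h _ ih => simp only [List.map_cons, List.sum_cons]; have := h.length_le; omega

theorem const_sum {α : Type*} (k : ℕ) (Xs : List (List α)) (h : ∀ X ∈ Xs, X.length = k) :
    (encB Xs).length = Xs.length * (k + 1) := by
  induction Xs with
  | nil => simp [encB]
  | cons a A ih =>
    simp only [List.mem_cons, forall_eq_or_imp] at h
    simp [encB, ih h.2, h.1]; ring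

theorem encB_rep {α : Type*} (W : List α) (n : ℕ) :
    encB (List.replicate (n + 1) W) = encB (List.replicate n W) ++ (none :: W.map some) := by
  rw [List.replicate_succ', encB_append]; simp [encB]

theorem forward {α : Type*} (Bs Cs : List (List α)) (D : List α) (SS : List (List α)) (k ℓ : ℕ)
    (hk : 1 ≤ k) (hℓ3 : 3 ≤ ℓ)
    (hℓ : (SS.map List.length).sum < k * (ℓ - 2))
    (h1 : Bs.length = ℓ) (h2 : ∀ B ∈ Bs, B.length ≤ k) (h3 : List.Forall₂ List.Sublist Cs SS)
    (h4 : D.length ≤ k) (T : List (Option α)) (hT : T = encB (Bs ++ Cs ++ [D]) ++ [none])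
    (i j L : ℕ) (hji : j < i) (hiL : i + L ≤ T.length)
    (heq : (T.drop j).take L = (T.drop i).take L)
    (hL : (k + 1) * (SS.length + ℓ) + 1 ≤ L) :
    ∃ W : List α, W.length = k ∧ ∀ w ∈ SS, W.Sublist w := by
  have hlen := h3.length_eq
  obtain ⟨Q, hQ⟩ := enc_cons (Cs ++ [D])
  have hTQ : T = encB Bs ++ none :: Q := by
    rw [hT, ← hQ, List.append_assoc, encB_append]; simp
  have hiq : i ≤ (encB Bs).length := by
    by_contra hcon
    have e1 : T.length = (encB Bs).length + (encB (Cs ++ [D])).length + 1 := by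
      rw [hT, List.append_assoc, encB_append]; simp; omega
    have e2 := encB_length (Cs ++ [D])
    have e3 := sum_sub Cs SS h3
    simp at e2
    obtain ⟨m, rfl⟩ : ∃ m, ℓ = m + 2 := ⟨ℓ - 2, by omega⟩
    simp only [Nat.add_sub_cancel] at hℓ
    have : L ≤ k * m + SS.length + 1 + k := by omega
    nlinarith
  have hcnt : cn T T.length = SS.length + ℓ + 2 := by
    rw [cn, List.take_length, hT, List.countP_append, countP_encB]
    simp; omega
  obtain ⟨rfl, hend, hci⟩ := main_pos T k (SS.length + ℓ) i j L (encB Bs).length (by omega)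
    (by intro t ht; rw [hTQ]; exact window0 k Bs h2 Q t ht) hji hiL hiq heq hL hcnt
    (by rw [hTQ]; exact head_enc _ _) (by rw [hT]; simp)
  cases Bs with
  | nil => simp at h1; omega
  | cons X Bs =>
    have hTX : T = (none :: X.map some) ++ (encB (Bs ++ Cs ++ [D]) ++ [none]) := by
      rw [hT]; simp [encB]
    set R := encB (Bs ++ Cs ++ [D]) ++ [none] with hR
    obtain ⟨R', hR'⟩ : ∃ R', R = none :: R' := enc_cons _
    have c1 : cn T (X.length + 1) = 1 := by
      have : X.length + 1 = (none :: X.map some).length := by simp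
      rw [cn, hTX, this, List.take_left]
      simp [-List.countP_map, countP_map_some]
    have hdX : T[X.length + 1]? = some none := by
      rw [hTX, List.getElem?_append_right (by simp)]
      simp [hR']
    have c2 := cn_dol T _ hdX
    have hdi : T[i]? = some none := by
      have := congrArg (fun l => l[0]?) heq
      have hL0 : 0 < L := by omega
      simp only [List.getElem?_take, hL0, List.getElem?_drop, if_true, add_zero] at this
      rw [← this, hTQ]; exact head_enc _ _
    have c3 := cn_dol T _ hdi
    have hi : i = X.length + 1 := by
      rcases Nat.lt_trichotomy i (X.length + 1) with h | h | h
      · have := cn_mono T (show i + 1 ≤ X.length + 1 by omega); omega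
      · exact h
      · have := cn_mono T (show X.length + 1 + 1 ≤ i by omega); omega
    have hdrop : T.drop i = R := by
      have : i = (none :: X.map some).length := by simp [hi]
      rw [this, hTX, List.drop_left]
    have hRL : R.length = L := by
      rw [← hdrop, List.length_drop]; omega
    have hpre : R <+: T := by
      rw [hdrop, ← hRL, List.take_length, List.drop_zero] at heq
      rw [← heq]; exact List.take_prefix _ _
    rw [hT, hR] at hpre
    have hp := enc_prefix _ _ hpre
    have hall := all_eq_of_prefix X (Bs ++ Cs ++ [D]) (by simpa using hp)
    have hRl : R.length = (Bs ++ Cs ++ [D]).length * (X.length + 1) + 1 := by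
      rw [hR, List.length_append, const_sum X.length _ (fun Y hY => by rw [hall Y hY])]; simp
    have hXk : X.length ≤ k := h2 X (by simp)
    have hN : (Bs ++ Cs ++ [D]).length = SS.length + ℓ := by
      simp at h1 ⊢; omega
    refine ⟨X, ?_, ?_⟩
    · rw [hRL, hN] at hRl
      by_contra hne
      have : X.length + 1 ≤ k := by omega
      have : (SS.length + ℓ) * (X.length + 1) ≤ (SS.length + ℓ) * k := Nat.mul_le_mul_left _ this
      nlinarith
    · have hC : ∀ Y ∈ Cs, Y = X := fun Y hY => hall Y (by simp [hY])
      clear * - h3 hC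
      induction h3 with
      | nil => simp
      | cons h _ ih =>
        simp only [List.mem_cons, forall_eq_or_imp] at hC ⊢
        exact ⟨hC.1 ▸ h, ih hC.2⟩

theorem backward {α : Type*} (SS : List (List α)) (k ℓ : ℕ) (W : List α) (hW : W.length = k)
    (h : ∀ w ∈ SS, W.Sublist w) :
    ∃ T ∈ GLang (lpfS SS k ℓ), ∃ i j L : ℕ, j < i ∧
      j + L ≤ T.length ∧ i + L ≤ T.length ∧
      (T.drop j).take L = (T.drop i).take L ∧
      (k + 1) * (SS.length + ℓ) + 1 ≤ L := by
  have hF : ∀ SS : List (List α), (∀ w ∈ SS, W.Sublist w) →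
      List.Forall₂ List.Sublist (List.replicate SS.length W) SS := by
    intro SS
    induction SS with
    | nil => intro _; exact List.Forall₂.nil
    | cons a A ih =>
      intro h
      simp only [List.mem_cons, forall_eq_or_imp] at h
      exact List.Forall₂.cons h.1 (ih h.2)
  have hrep : List.replicate ℓ W ++ List.replicate SS.length W ++ [W]
      = List.replicate (SS.length + ℓ + 1) W := by
    rw [← List.replicate_add, ← List.replicate_succ', Nat.add_comm ℓ]
  set N := SS.length + ℓ with hNdef
  have hl : ∀ n, (encB (List.replicate n W)).length = n * (k + 1) := by
    intro n
    rw [const_sum k _ (fun X hX => by rw [List.eq_of_mem_replicate hX, hW])]; simp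
  have hT1 : encB (List.replicate (N + 1) W) ++ [none]
      = (encB (List.replicate N W) ++ [none]) ++ (W.map some ++ [none]) := by
    rw [encB_rep]; simp
  have hT2 : encB (List.replicate (N + 1) W) ++ [none]
      = (none :: W.map some) ++ (encB (List.replicate N W) ++ [none]) := by
    rw [List.replicate_succ]; simp [encB]
  have hlen : (encB (List.replicate (N + 1) W) ++ [none]).length = N * (k + 1) + (k + 1) + 1 := by
    rw [List.length_append, hl]; simp; ring
  refine ⟨encB (List.replicate (N + 1) W) ++ [none], ?_, k + 1, 0, N * (k + 1) + 1, by omega,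
    by omega, by omega, ?_, by rw [Nat.mul_comm]⟩
  · rw [GLang_lpfS]
    exact ⟨List.replicate ℓ W, List.replicate SS.length W, W, by simp,
      fun B hB => by rw [List.eq_of_mem_replicate hB, hW], hF SS h, hW.le, by rw [hrep]⟩
  · have e : N * (k + 1) + 1 = (encB (List.replicate N W) ++ [none]).length := by
      rw [List.length_append, hl]; simp
    have e2 : k + 1 = (none :: W.map some).length := by simp [hW]
    have a1 : ((encB (List.replicate (N + 1) W) ++ [none]).drop 0).take (N * (k + 1) + 1)
        = encB (List.replicate N W) ++ [none] := by
      rw [hT1, List.drop_zero, e, List.take_left]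
    have a2 : (encB (List.replicate (N + 1) W) ++ [none]).drop (k + 1)
        = encB (List.replicate N W) ++ [none] := by
      rw [hT2, e2, List.drop_left]
    rw [a1, a2, e, List.take_length]

end LPFAux

/-- Let `S_1, …, S_f` (`f ≥ 1`) be nonempty strings over `Σ`,
`k ≥ 1`, and `ℓ ≥ 3` minimal with `k(ℓ-2) > |S_1| + ⋯ + |S_f|`. Then there exist
a string `T ∈ L(S)` of the constructed ED string `S` and a position `i` of `T`
with longest-previous-factor length `LPF(T)[i] ≥ (k+1)(f+ℓ)+1` (i.e., a factor
of length `L ≥ (k+1)(f+ℓ)+1` starting at `i` also occurs at an earlier position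
`j < i`, both occurrences lying within `T`) iff `S_1, …, S_f` have a common
subsequence of length `k`. -/
theorem lpf_long_iff_common_subsequence {α : Type*} (SS : List (List α)) (hf : SS ≠ [])
    (hne : ∀ w ∈ SS, w ≠ []) (k : ℕ) (hk : 1 ≤ k) (ℓ : ℕ) (hℓ3 : 3 ≤ ℓ)
    (hℓ : (SS.map List.length).sum < k * (ℓ - 2))
    (hℓmin : ∀ ℓ' : ℕ, 3 ≤ ℓ' → (SS.map List.length).sum < k * (ℓ' - 2) → ℓ ≤ ℓ') :
    (∃ T ∈ GLang (lpfS SS k ℓ), ∃ i j L : ℕ, j < i ∧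
      j + L ≤ T.length ∧ i + L ≤ T.length ∧
      (T.drop j).take L = (T.drop i).take L ∧
      (k + 1) * (SS.length + ℓ) + 1 ≤ L) ↔
    ∃ W : List α, W.length = k ∧ ∀ w ∈ SS, W.Sublist w := by
  constructor
  · rintro ⟨T, hT, i, j, L, hji, -, hiL, heq, hL⟩
    rw [LPFAux.GLang_lpfS] at hT
    obtain ⟨Bs, Cs, D, h1, h2, h3, h4, hT⟩ := hT
    exact LPFAux.forward Bs Cs D SS k ℓ hk hℓ3 hℓ h1 h2 h3 h4 T hT i j L hji hiL heq hL
  · rintro ⟨W, hW, h⟩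
    exact LPFAux.backward SS k ℓ W hW h
end

section
/- Let F = C_1 ∧ … ∧ C_m be a 3-CNF formula over n Boolean variables and let T_1,…,T_m be the indeterminate strings of length n constructed from the clauses of F as described. Then the union L(T_1) ∪ L(T_2) ∪ ⋯ ∪ L(T_m) is a proper subset of {0,1}^n if and only if F is satisfiable; equivalently, the union equals {0,1}^n if and only if F is unsatisfiable. -/
/-- A 3-clause over Boolean variables `x_0, …, x_{n-1}`: it consists of three
literals on three distinct variables `a < b < c`; the Booleans `na`, `nb`, `nc`
record whether the respective literal is negated (so, in the paper's notation,
`v_a = na`, `v_b = nb`, `v_c = nc`, reading the bit `0` as `false` and `1` as `true`). -/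
structure Clause3 (n : ℕ) where
  a : Fin n
  b : Fin n
  c : Fin n
  hab : a < b
  hbc : b < c
  na : Bool
  nb : Bool
  nc : Bool

/-- The clause `C` is satisfied by the assignment `σ`:
some literal of `C` evaluates to true. -/
def Clause3.Sat {n : ℕ} (C : Clause3 n) (σ : Fin n → Bool) : Prop :=
  σ C.a ≠ C.na ∨ σ C.b ≠ C.nb ∨ σ C.c ≠ C.nc

/-- The language of an indeterminate string `S` (a list of nonempty sets of
characters): all classic strings of the same length as `S` choosing, at each
position, a character of the corresponding symbol. -/
def Lang {α : Type*} (S : List (Set α)) : Set (List α) :=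
  {X | List.Forall₂ (fun x A => x ∈ A) X S}

/-- The classic string `P` occurs in the indeterminate string `S` at
(0-based) position `i`: some `X ∈ L(S)` has `P` as the substring of
length `|P|` starting at position `i`. -/
def OccursAt {α : Type*} (S : List (Set α)) (P : List α) (i : ℕ) : Prop :=
  ∃ X ∈ Lang S, (X.drop i).take P.length = P

/-- We model the alphabet `{0, 1, $}` as `Option Bool`:
`some false` is `0`, `some true` is `1`, and `none` is `$`. -/
abbrev OB := Option Bool

/-- The symbol `{0, 1}`. -/
def bitSym : Set OB := {some false, some true}

/-- The symbol `{$}`. -/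
def dolSym : Set OB := {none}

/-- The symbol `{0, 1, $}`. -/
def triSym : Set OB := {some false, some true, none}

/-- The indeterminate string `T_j` (over `{0,1}`, here embedded into `{0,1,$}`)
built from the clause `C = C_j`: position `a` carries `{v_a}`, position `b`
carries `{v_b}`, position `c` carries `{v_c}`, every other position carries `{0,1}`. -/
def clauseStr (n : ℕ) (C : Clause3 n) : List (Set OB) :=
  (List.finRange n).map fun i =>
    if i = C.a then {some C.na}
    else if i = C.b then {some C.nb}
    else if i = C.c then {some C.nc}
    else bitSym

/-- The indeterminate string
`S = T_1 · {$} · … · {$} · T_m · {$} · {0,1}^n · {$} · {0,1}^{n-1} · {$} · {0,1}^{n-1}`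
of the MUS reduction. -/
def musS (n : ℕ) (F : List (Clause3 n)) : List (Set OB) :=
  (F.map fun C => clauseStr n C ++ [dolSym]).flatten ++
    List.replicate n bitSym ++ [dolSym] ++
    List.replicate (n - 1) bitSym ++ [dolSym] ++
    List.replicate (n - 1) bitSym

/-- The indeterminate string
`S' = T_1 · {$} · … · {$} · T_m · {$} · {0,1,$}^{n-1} · {$} · {0,1}^{n-1}`
of the MAW (absent word) reduction. -/
def mawS (n : ℕ) (F : List (Clause3 n)) : List (Set OB) :=
  (F.map fun C => clauseStr n C ++ [dolSym]).flatten ++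
    List.replicate (n - 1) triSym ++ [dolSym] ++
    List.replicate (n - 1) bitSym

/-- The bitstring (over `{0,1} ⊆ {0,1,$}`) of length `n` encoding the
assignment `σ`: its `i`-th character is `1` iff `σ i` is true. -/
def bits {n : ℕ} (σ : Fin n → Bool) : List OB :=
  List.ofFn fun i => some (σ i)

theorem aux_mem_iff {n : ℕ} (B : List OB) :
    (B.length = n ∧ (none : OB) ∉ B) ↔ ∃ σ : Fin n → Bool, B = bits σ := by
  constructor
  · rintro ⟨h, hB⟩
    subst h
    refine ⟨fun i => (B.get i).getD false, ?_⟩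
    apply List.ext_getElem
    · simp [bits]
    · intro i h1 h2
      have : B[i] ≠ none := fun h => hB (h ▸ List.getElem_mem h1)
      obtain ⟨b, hb⟩ := Option.ne_none_iff_exists'.1 this
      simp [bits, hb]
  · rintro ⟨σ, rfl⟩
    simp [bits, List.mem_ofFn]

theorem aux_lang_iff {n : ℕ} (C : Clause3 n) (X : List OB) :
    X ∈ Lang (clauseStr n C) ↔ ∃ σ : Fin n → Bool, X = bits σ ∧ ¬ C.Sat σ := by
  have hab := C.hab.ne
  have hbc := C.hbc.ne
  have hac := (C.hab.trans C.hbc).ne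
  simp only [Lang, Set.mem_setOf_eq, List.forall₂_iff_get]
  constructor
  · rintro ⟨hl, h⟩
    have hn : X.length = n := by simpa [clauseStr] using hl
    have h' : ∀ (i : Fin n), X[i.1]'(by omega) ∈ (if i = C.a then ({some C.na} : Set OB)
        else if i = C.b then {some C.nb}
        else if i = C.c then {some C.nc}
        else bitSym) := by
      intro i
      have := h i.1 (by omega) (by simp [clauseStr])
      simpa [clauseStr] using this
    have hB : (none : OB) ∉ X := by
      intro hm
      obtain ⟨i, hi, he⟩ := List.getElem_of_mem hm
      have := h' ⟨i, by omega⟩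
      simp only [he] at this
      split_ifs at this <;> simp [bitSym] at this
    obtain ⟨σ, rfl⟩ := (aux_mem_iff X).1 ⟨hn, hB⟩
    refine ⟨σ, rfl, ?_⟩
    have ha := h' C.a
    have hb := h' C.b
    have hc := h' C.c
    simp [bits, hab.symm] at ha
    simp [bits, hab.symm] at hb
    simp [bits, hac.symm, hbc.symm] at hc
    simp [Clause3.Sat, ha, hb, hc]
  · rintro ⟨σ, rfl, hs⟩
    simp only [Clause3.Sat, not_or, not_not] at hs
    obtain ⟨ha, hb, hc⟩ := hs
    refine ⟨by simp [bits, clauseStr], ?_⟩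
    intro i h1 h2
    simp only [bits, clauseStr, List.get_eq_getElem, List.getElem_ofFn, List.getElem_map,
      List.getElem_finRange]
    split_ifs with e1 e2 e3
    · rw [← ha, ← e1]; simp
    · rw [← hb, ← e2]; simp
    · rw [← hc, ← e3]; simp
    · simp only [bitSym, Set.mem_insert_iff, Set.mem_singleton_iff, Option.some.injEq]
      exact Bool.eq_false_or_eq_true _ |>.symm

theorem aux_bits_inj {n : ℕ} {σ τ : Fin n → Bool} (h : bits σ = bits τ) : σ = τ := by
  have := List.ofFn_injective h
  funext i
  simpa using congrFun this i

/-- The union `L(T_1) ∪ ⋯ ∪ L(T_m)` of the languages of the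
indeterminate strings built from the clauses of `F` is a proper subset of
`{0,1}^n` iff `F` is satisfiable; equivalently, the union equals `{0,1}^n`
iff `F` is unsatisfiable. (Here `{0,1}^n` is the set of strings of length `n`
over `{0,1}`, i.e., over the alphabet `{0,1,$}` avoiding the character `$`.) -/
theorem union_clause_langs_proper_iff_satisfiable (n : ℕ) (F : List (Clause3 n)) :
    ((⋃ C ∈ F, Lang (clauseStr n C)) ⊂
        {B : List OB | B.length = n ∧ (none : OB) ∉ B} ↔
      ∃ σ : Fin n → Bool, ∀ C ∈ F, C.Sat σ) ∧
    ((⋃ C ∈ F, Lang (clauseStr n C)) =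
        {B : List OB | B.length = n ∧ (none : OB) ∉ B} ↔
      ¬ ∃ σ : Fin n → Bool, ∀ C ∈ F, C.Sat σ) := by
  have hsub : (⋃ C ∈ F, Lang (clauseStr n C)) ⊆
      {B : List OB | B.length = n ∧ (none : OB) ∉ B} := by
    intro X hX
    simp only [Set.mem_iUnion] at hX
    obtain ⟨C, _, hX⟩ := hX
    obtain ⟨σ, rfl, _⟩ := (aux_lang_iff C X).1 hX
    exact (aux_mem_iff _).2 ⟨σ, rfl⟩
  have key : (⋃ C ∈ F, Lang (clauseStr n C)) =
        {B : List OB | B.length = n ∧ (none : OB) ∉ B} ↔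
      ¬ ∃ σ : Fin n → Bool, ∀ C ∈ F, C.Sat σ := by
    constructor
    · rintro h ⟨σ, hσ⟩
      have hm : bits σ ∈ {B : List OB | B.length = n ∧ (none : OB) ∉ B} :=
        (aux_mem_iff _).2 ⟨σ, rfl⟩
      rw [← h] at hm
      simp only [Set.mem_iUnion] at hm
      obtain ⟨C, hC, hX⟩ := hm
      obtain ⟨τ, e, ht⟩ := (aux_lang_iff C _).1 hX
      rw [← aux_bits_inj e] at ht
      exact ht (hσ C hC)
    · intro h
      refine Set.Subset.antisymm hsub ?_
      intro B hB
      obtain ⟨σ, rfl⟩ := (aux_mem_iff B).1 hB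
      push Not at h
      obtain ⟨C, hC, hs⟩ := h σ
      simp only [Set.mem_iUnion]
      exact ⟨C, hC, (aux_lang_iff C _).2 ⟨σ, rfl, hs⟩⟩
  refine ⟨?_, key⟩
  rw [Set.ssubset_iff_subset_ne, ne_eq, key, not_not]
  exact ⟨fun h => h.2, fun h => ⟨hsub, h⟩⟩
end
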